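/- Per-model soundness and completeness of G (the key lemma of the paper's completeness theorem, restricted to formulas without nested modal operators): let v be a many-valued valuation and let T_v be the set of sequents {1 ⊢ [x]A and [x]A ⊢ 1 : A ∈ H, x ∈ X, v(A) = x} ∪ {[x]A ⊢ 0 and 0 ⊢ [x]A : A ∈ H, x ∈ X, v(A) ≠ x}. Then for all formulas Φ, Ψ ∈ L_M with no nested modal operators, the sequent Φ ⊢ Ψ is derivable from T_v in G if and only if 𝔉(v)(Φ) ≤ 𝔉(v)(Ψ). -/

import Mathlib

/-- Propositional formulas of the many-valued logic `L`, generated from atoms in `H`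
by unary connectives indexed by `U` and binary connectives indexed by `B`. -/
inductive Fml (H U B : Type) : Type
  | atom : H → Fml H U B
  | un : U → Fml H U B → Fml H U B
  | bin : B → Fml H U B → Fml H U B → Fml H U B

/-- The multi-modal 2-valued language `L_M`. -/
inductive MFml (X H U B : Type) : Type
  | bot : MFml X H U B
  | top : MFml X H U B
  | box : X → Fml H U B → MFml X H U B
  | bbox : Bool → MFml X H U B → MFml X H U B
  | and : MFml X H U B → MFml X H U B → MFml X H U B
  | or : MFml X H U B → MFml X H U B → MFml X H U B

variable {X H U B : Type}

/-- Homomorphic extension of a many-valued valuation `v : H → X` to all formulas,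
where the unary connective `u` is interpreted by `su u` and the binary connective
`c` by `bo c`. -/
def mvVal (su : U → X → X) (bo : B → X → X → X) (v : H → X) : Fml H U B → X
  | .atom a => v a
  | .un u φ => su u (mvVal su bo v φ)
  | .bin c φ ψ => bo c (mvVal su bo v φ) (mvVal su bo v ψ)

/-- The modal valuation `𝔉(v) : L_M → 2`. -/
def mval [DecidableEq X] (su : U → X → X) (bo : B → X → X → X) (v : H → X) :
    MFml X H U B → Bool
  | .bot => false
  | .top => true
  | .box x φ => decide (mvVal su bo v φ = x)
  | .bbox b Φ => decide (mval su bo v Φ = b)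
  | .and Φ Ψ => mval su bo v Φ && mval su bo v Ψ
  | .or Φ Ψ => mval su bo v Φ || mval su bo v Ψ

/-- Finite disjunction (empty disjunction is `0`). -/
def bigOr : List (MFml X H U B) → MFml X H U B
  | [] => .bot
  | Φ :: l => .or Φ (bigOr l)

/-- Finite conjunction (empty conjunction is `1`). -/
def bigAnd : List (MFml X H U B) → MFml X H U B
  | [] => .top
  | Φ :: l => .and Φ (bigAnd l)

/-- `⋁_{y ∈ X : x = s(y)} [y]φ`. -/
noncomputable def unDisj [Fintype X] [DecidableEq X] (su : U → X → X) (x : X) (u : U)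
    (φ : Fml H U B) : MFml X H U B :=
  bigOr (((Finset.univ.filter fun y => x = su u y)).toList.map fun y => .box y φ)

/-- `⋁_{(y,z) ∈ X×X : x = o(y,z)} ([y]φ ∧ [z]ψ)`. -/
noncomputable def binDisj [Fintype X] [DecidableEq X] (bo : B → X → X → X) (x : X) (c : B)
    (φ ψ : Fml H U B) : MFml X H U B :=
  bigOr (((Finset.univ.filter fun p : X × X => x = bo c p.1 p.2)).toList.map
    fun p => .and (.box p.1 φ) (.box p.2 ψ))

/-- `⋁_{(b1,b2) ∈ 2×2 : b = op(b1,b2)} ([b1]Φ ∧ [b2]Ψ)`. -/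
noncomputable def boolDisj (op : Bool → Bool → Bool) (b : Bool) (Φ Ψ : MFml X H U B) : MFml X H U B :=
  bigOr (((Finset.univ.filter fun p : Bool × Bool => b = op p.1 p.2)).toList.map
    fun p => .and (.bbox p.1 Φ) (.bbox p.2 Ψ))

/-- The derivability relation `Γ ⊩ (Φ ⊢ Ψ)` of the Gentzen system `G`. -/
inductive Deriv [Fintype X] [DecidableEq X] (su : U → X → X) (bo : B → X → X → X)
    (Γ : Set (MFml X H U B × MFml X H U B)) : MFml X H U B → MFml X H U B → Prop
  | hyp {Φ Ψ} : (Φ, Ψ) ∈ Γ → Deriv su bo Γ Φ Ψ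
  | refl (Φ) : Deriv su bo Γ Φ Φ
  | top (Φ) : Deriv su bo Γ Φ .top
  | bot (Φ) : Deriv su bo Γ .bot Φ
  | andE1 (Φ Ψ) : Deriv su bo Γ (.and Φ Ψ) Φ
  | andE2 (Φ Ψ) : Deriv su bo Γ (.and Φ Ψ) Ψ
  | orI1 (Φ Ψ) : Deriv su bo Γ Φ (.or Φ Ψ)
  | orI2 (Φ Ψ) : Deriv su bo Γ Φ (.or Ψ Φ)
  | distrib (Φ Ψ Υ) :
      Deriv su bo Γ (.and Φ (.or Ψ Υ)) (.or (.and Φ Ψ) (.and Φ Υ))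
  | introBoolAnd (b Φ Ψ) :
      Deriv su bo Γ (boolDisj (· && ·) b Φ Ψ) (.bbox b (.and Φ Ψ))
  | introBoolOr (b Φ Ψ) :
      Deriv su bo Γ (boolDisj (· || ·) b Φ Ψ) (.bbox b (.or Φ Ψ))
  | introUn (x u φ) : Deriv su bo Γ (unDisj su x u φ) (.box x (.un u φ))
  | introBin (x c φ ψ) : Deriv su bo Γ (binDisj bo x c φ ψ) (.box x (.bin c φ ψ))
  | elimBoolAnd (b Φ Ψ) :
      Deriv su bo Γ (.bbox b (.and Φ Ψ)) (boolDisj (· && ·) b Φ Ψ)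
  | elimBoolOr (b Φ Ψ) :
      Deriv su bo Γ (.bbox b (.or Φ Ψ)) (boolDisj (· || ·) b Φ Ψ)
  | elimUn (x u φ) : Deriv su bo Γ (.box x (.un u φ)) (unDisj su x u φ)
  | elimBin (x c φ ψ) : Deriv su bo Γ (.box x (.bin c φ ψ)) (binDisj bo x c φ ψ)
  | cut {Φ Ψ Υ} : Deriv su bo Γ Φ Ψ → Deriv su bo Γ Ψ Υ → Deriv su bo Γ Φ Υ
  | lowerBound {Φ Ψ Υ} :
      Deriv su bo Γ Φ Ψ → Deriv su bo Γ Φ Υ → Deriv su bo Γ Φ (.and Ψ Υ)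
  | upperBound {Φ Ψ Υ} :
      Deriv su bo Γ Φ Ψ → Deriv su bo Γ Υ Ψ → Deriv su bo Γ (.or Φ Υ) Ψ

/-- Formulas of `L_M` with no nested modal operators. -/
inductive NoNest : MFml X H U B → Prop
  | bot : NoNest .bot
  | top : NoNest .top
  | box (x φ) : NoNest (.box x φ)
  | and {Φ Ψ} : NoNest Φ → NoNest Ψ → NoNest (.and Φ Ψ)
  | or {Φ Ψ} : NoNest Φ → NoNest Ψ → NoNest (.or Φ Ψ)

/-- The canonical reduct of `[x]φ` (Definition 3 of the paper). -/
noncomputable def reduct [Fintype X] [DecidableEq X] (su : U → X → X) (bo : B → X → X → X) :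
    Fml H U B → X → MFml X H U B
  | .atom A, x => .box x (.atom A)
  | .un u φ, x =>
      bigOr (((Finset.univ.filter fun y => x = su u y)).toList.map
        fun y => reduct su bo φ y)
  | .bin c φ ψ, x =>
      bigOr (((Finset.univ.filter fun p : X × X => x = bo c p.1 p.2)).toList.map
        fun p => .and (reduct su bo φ p.1) (reduct su bo ψ p.2))

/-- Homomorphic extension of a substitution `σ : H → L` to `L`. -/
def subFml (σ : H → Fml H U B) : Fml H U B → Fml H U B
  | .atom A => σ A
  | .un u φ => .un u (subFml σ φ)
  | .bin c φ ψ => .bin c (subFml σ φ) (subFml σ ψ)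

/-- Extension `σ_M : L_M → L_M` of a substitution. -/
def subM (σ : H → Fml H U B) : MFml X H U B → MFml X H U B
  | .bot => .bot
  | .top => .top
  | .box x φ => .box x (subFml σ φ)
  | .bbox b Φ => .bbox b (subM σ Φ)
  | .and Φ Ψ => .and (subM σ Φ) (subM σ Ψ)
  | .or Φ Ψ => .or (subM σ Φ) (subM σ Ψ)

/-- Satisfaction at a possible world of the autoreferential Kripke model
(worlds `W = X ⊕ 2`, accessibility `R_u = W × {u}`). -/
def sat (su : U → X → X) (bo : B → X → X → X) (v : H → X) :
    (X ⊕ Bool) → MFml X H U B → Prop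
  | _, .bot => False
  | _, .top => True
  | _, .box x φ => mvVal su bo v φ = x
  | _, .bbox b Φ => sat su bo v (Sum.inr b) Φ
  | w, .and Φ Ψ => sat su bo v w Φ ∧ sat su bo v w Ψ
  | w, .or Φ Ψ => sat su bo v w Φ ∨ sat su bo v w Ψ

/-- The sequent bivaluation `𝔅(v)`. -/
def biv [DecidableEq X] (su : U → X → X) (bo : B → X → X → X) (v : H → X)
    (s : MFml X H U B × MFml X H U B) : Bool :=
  decide (mval su bo v s.1 = (mval su bo v s.1 && mval su bo v s.2))

/-- Modal literal `[y₁]…[y_{k-1}][x]A`. -/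
def modalLit (l : List Bool) (x : X) (A : H) : MFml X H U B :=
  l.foldr (fun b Φ => MFml.bbox b Φ) (MFml.box x (Fml.atom A))

/-- The theory `T_v` determined by a many-valued valuation `v`. -/
def Tv (v : H → X) : Set (MFml X H U B × MFml X H U B) :=
  {s | ∃ (A : H) (x : X), v A = x ∧
      (s = (MFml.top, MFml.box x (Fml.atom A)) ∨
       s = (MFml.box x (Fml.atom A), MFml.top))} ∪
  {s | ∃ (A : H) (x : X), v A ≠ x ∧
      (s = (MFml.box x (Fml.atom A), MFml.bot) ∨
       s = (MFml.bot, MFml.box x (Fml.atom A)))}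

/-- The derivability relation of the Gentzen system `G` extended with the
substitution rule. -/
inductive DerivS [Fintype X] [DecidableEq X] (su : U → X → X) (bo : B → X → X → X)
    (Γ : Set (MFml X H U B × MFml X H U B)) : MFml X H U B → MFml X H U B → Prop
  | hyp {Φ Ψ} : (Φ, Ψ) ∈ Γ → DerivS su bo Γ Φ Ψ
  | refl (Φ) : DerivS su bo Γ Φ Φ
  | top (Φ) : DerivS su bo Γ Φ .top
  | bot (Φ) : DerivS su bo Γ .bot Φ
  | andE1 (Φ Ψ) : DerivS su bo Γ (.and Φ Ψ) Φ
  | andE2 (Φ Ψ) : DerivS su bo Γ (.and Φ Ψ) Ψ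
  | orI1 (Φ Ψ) : DerivS su bo Γ Φ (.or Φ Ψ)
  | orI2 (Φ Ψ) : DerivS su bo Γ Φ (.or Ψ Φ)
  | distrib (Φ Ψ Υ) :
      DerivS su bo Γ (.and Φ (.or Ψ Υ)) (.or (.and Φ Ψ) (.and Φ Υ))
  | introBoolAnd (b Φ Ψ) :
      DerivS su bo Γ (boolDisj (· && ·) b Φ Ψ) (.bbox b (.and Φ Ψ))
  | introBoolOr (b Φ Ψ) :
      DerivS su bo Γ (boolDisj (· || ·) b Φ Ψ) (.bbox b (.or Φ Ψ))
  | introUn (x u φ) : DerivS su bo Γ (unDisj su x u φ) (.box x (.un u φ))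
  | introBin (x c φ ψ) : DerivS su bo Γ (binDisj bo x c φ ψ) (.box x (.bin c φ ψ))
  | elimBoolAnd (b Φ Ψ) :
      DerivS su bo Γ (.bbox b (.and Φ Ψ)) (boolDisj (· && ·) b Φ Ψ)
  | elimBoolOr (b Φ Ψ) :
      DerivS su bo Γ (.bbox b (.or Φ Ψ)) (boolDisj (· || ·) b Φ Ψ)
  | elimUn (x u φ) : DerivS su bo Γ (.box x (.un u φ)) (unDisj su x u φ)
  | elimBin (x c φ ψ) : DerivS su bo Γ (.box x (.bin c φ ψ)) (binDisj bo x c φ ψ)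
  | cut {Φ Ψ Υ} : DerivS su bo Γ Φ Ψ → DerivS su bo Γ Ψ Υ → DerivS su bo Γ Φ Υ
  | lowerBound {Φ Ψ Υ} :
      DerivS su bo Γ Φ Ψ → DerivS su bo Γ Φ Υ → DerivS su bo Γ Φ (.and Ψ Υ)
  | upperBound {Φ Ψ Υ} :
      DerivS su bo Γ Φ Ψ → DerivS su bo Γ Υ Ψ → DerivS su bo Γ (.or Φ Υ) Ψ
  | subst {Φ Ψ} (σ : H → Fml H U B) :
      DerivS su bo Γ Φ Ψ → DerivS su bo Γ (subM σ Φ) (subM σ Ψ)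

theorem mval_box [DecidableEq X] (su : U → X → X) (bo : B → X → X → X) (v : H → X)
    (x : X) (φ : Fml H U B) : mval su bo v (.box x φ) = true ↔ mvVal su bo v φ = x :=
  decide_eq_true_iff

theorem mval_bbox [DecidableEq X] (su : U → X → X) (bo : B → X → X → X) (v : H → X)
    (b : Bool) (Φ : MFml X H U B) : mval su bo v (.bbox b Φ) = true ↔ mval su bo v Φ = b :=
  decide_eq_true_iff

theorem mval_and [DecidableEq X] (su : U → X → X) (bo : B → X → X → X) (v : H → X)
    (Φ Ψ : MFml X H U B) :
    mval su bo v (.and Φ Ψ) = (mval su bo v Φ && mval su bo v Ψ) :=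
  rfl

theorem mval_or [DecidableEq X] (su : U → X → X) (bo : B → X → X → X) (v : H → X)
    (Φ Ψ : MFml X H U B) :
    mval su bo v (.or Φ Ψ) = (mval su bo v Φ || mval su bo v Ψ) :=
  rfl

theorem mval_bigOr [DecidableEq X] (su : U → X → X) (bo : B → X → X → X) (v : H → X)
    (l : List (MFml X H U B)) :
    mval su bo v (bigOr l) = true ↔ ∃ Φ ∈ l, mval su bo v Φ = true := by
  induction l with
  | nil => simp [bigOr, mval]
  | cons Φ l ih => simp [bigOr, mval, ih]

theorem mval_boolDisj [DecidableEq X] (su : U → X → X) (bo : B → X → X → X) (v : H → X)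
    (op : Bool → Bool → Bool) (b : Bool) (Φ Ψ : MFml X H U B) :
    mval su bo v (boolDisj op b Φ Ψ) = true ↔
      op (mval su bo v Φ) (mval su bo v Ψ) = b := by
  simp only [boolDisj, mval_bigOr, List.mem_map, Finset.mem_toList, Finset.mem_filter,
    Finset.mem_univ, true_and, exists_exists_and_eq_and, mval_bbox, mval_and,
    Bool.and_eq_true]
  constructor
  · rintro ⟨p, h, h₁, h₂⟩
    rw [h, h₁, h₂]
  · rintro rfl
    exact ⟨(_, _), rfl, rfl, rfl⟩

theorem mval_unDisj [Fintype X] [DecidableEq X] (su : U → X → X) (bo : B → X → X → X)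
    (v : H → X) (x : X) (u : U) (φ : Fml H U B) :
    mval su bo v (unDisj su x u φ) = mval su bo v (.box x (.un u φ)) := by
  rw [Bool.eq_iff_iff]
  simp only [unDisj, mval_bigOr, List.mem_map, Finset.mem_toList, Finset.mem_filter,
    Finset.mem_univ, true_and, exists_exists_and_eq_and, mval_box, mvVal]
  constructor
  · rintro ⟨y, h, h₁⟩
    rw [h, h₁]
  · rintro rfl
    exact ⟨_, rfl, rfl⟩

theorem mval_binDisj [Fintype X] [DecidableEq X] (su : U → X → X) (bo : B → X → X → X)
    (v : H → X) (x : X) (c : B) (φ ψ : Fml H U B) :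
    mval su bo v (binDisj bo x c φ ψ) = mval su bo v (.box x (.bin c φ ψ)) := by
  rw [Bool.eq_iff_iff]
  simp only [binDisj, mval_bigOr, List.mem_map, Finset.mem_toList, Finset.mem_filter,
    Finset.mem_univ, true_and, exists_exists_and_eq_and, mval_box, mval_and, mvVal,
    Bool.and_eq_true]
  constructor
  · rintro ⟨p, h, h₁, h₂⟩
    rw [h, h₁, h₂]
  · rintro rfl
    exact ⟨(_, _), rfl, rfl, rfl⟩

/-- A valuation satisfying all assumptions satisfies every derivable sequent. -/
theorem Deriv.sound [Fintype X] [DecidableEq X] {su : U → X → X} {bo : B → X → X → X}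
    {Γ : Set (MFml X H U B × MFml X H U B)} {v : H → X}
    (hΓ : ∀ s ∈ Γ, mval su bo v s.1 = true → mval su bo v s.2 = true)
    {Φ Ψ : MFml X H U B} (h : Deriv su bo Γ Φ Ψ) :
    mval su bo v Φ = true → mval su bo v Ψ = true := by
  induction h with
  | hyp h => exact hΓ _ h
  | introBoolAnd | introBoolOr | elimBoolAnd | elimBoolOr =>
    simp [mval_boolDisj, mval_bbox, mval_and, mval_or]
  | introUn | elimUn => simp [mval_unDisj]
  | introBin | elimBin => simp [mval_binDisj]
  | _ => simp_all [mval] <;> grind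

theorem mval_of_mem_Tv [DecidableEq X] (su : U → X → X) (bo : B → X → X → X) (v : H → X)
    (s : MFml X H U B × MFml X H U B) (hs : s ∈ Tv v) :
    mval su bo v s.1 = true → mval su bo v s.2 = true := by
  rcases hs with ⟨A, x, h, rfl | rfl⟩ | ⟨A, x, h, rfl | rfl⟩ <;> simp [mval, mvVal, h]

theorem Deriv.bigOr_right [Fintype X] [DecidableEq X] {su : U → X → X} {bo : B → X → X → X}
    {Γ : Set (MFml X H U B × MFml X H U B)} {Φ : MFml X H U B} {l : List (MFml X H U B)}
    (h : Φ ∈ l) : Deriv su bo Γ Φ (bigOr l) := by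
  induction l with
  | nil => simp at h
  | cons Ψ l ih =>
    rcases List.mem_cons.1 h with rfl | h
    · exact .orI1 _ _
    · exact .cut (ih h) (.orI2 _ _)

theorem Deriv.bigOr_left [Fintype X] [DecidableEq X] {su : U → X → X} {bo : B → X → X → X}
    {Γ : Set (MFml X H U B × MFml X H U B)} {Ψ : MFml X H U B} {l : List (MFml X H U B)}
    (h : ∀ Φ ∈ l, Deriv su bo Γ Φ Ψ) : Deriv su bo Γ (bigOr l) Ψ := by
  induction l with
  | nil => exact .bot _
  | cons Φ l ih =>
    exact .upperBound (h _ (by simp)) (ih fun Υ hΥ => h _ (by simp [hΥ]))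

theorem deriv_Tv_box [Fintype X] [DecidableEq X] (su : U → X → X) (bo : B → X → X → X)
    (v : H → X) (φ : Fml H U B) :
    Deriv su bo (Tv v) .top (.box (mvVal su bo v φ) φ) ∧
      ∀ x, mvVal su bo v φ ≠ x → Deriv su bo (Tv v) (.box x φ) .bot := by
  induction φ with
  | atom A =>
    exact ⟨.hyp (.inl ⟨A, _, rfl, .inl rfl⟩), fun x h => .hyp (.inr ⟨A, x, h, .inl rfl⟩)⟩
  | un u φ ih =>
    refine ⟨.cut ih.1 (.cut (.bigOr_right ?_) (.introUn _ _ _)),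
      fun x h => .cut (.elimUn _ _ _) (.bigOr_left ?_)⟩
    · simp only [List.mem_map, Finset.mem_toList, Finset.mem_filter, Finset.mem_univ, true_and]
      exact ⟨_, rfl, rfl⟩
    · simp only [List.mem_map, Finset.mem_toList, Finset.mem_filter, Finset.mem_univ, true_and]
      rintro _ ⟨y, hy, rfl⟩
      exact ih.2 y fun e => h (by rw [hy, ← e, mvVal])
  | bin c φ ψ ih₁ ih₂ =>
    refine ⟨.cut (.lowerBound ih₁.1 ih₂.1) (.cut (.bigOr_right ?_) (.introBin _ _ _ _)),
      fun x h => .cut (.elimBin _ _ _ _) (.bigOr_left ?_)⟩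
    · simp only [List.mem_map, Finset.mem_toList, Finset.mem_filter, Finset.mem_univ, true_and]
      exact ⟨(_, _), rfl, rfl⟩
    · simp only [List.mem_map, Finset.mem_toList, Finset.mem_filter, Finset.mem_univ, true_and]
      rintro _ ⟨⟨y, z⟩, hp, rfl⟩
      by_cases e₁ : mvVal su bo v φ = y
      · refine .cut (.andE2 _ _) (ih₂.2 z fun e₂ => h ?_)
        rw [hp, ← e₁, ← e₂, mvVal]
      · exact .cut (.andE1 _ _) (ih₁.2 y e₁)

/-- `T_v` decides every formula without nested modal operators according to its value. -/
theorem NoNest.deriv_Tv [Fintype X] [DecidableEq X] (su : U → X → X) (bo : B → X → X → X)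
    (v : H → X) {Φ : MFml X H U B} (hΦ : NoNest Φ) :
    (mval su bo v Φ = true → Deriv su bo (Tv v) .top Φ) ∧
      (mval su bo v Φ = false → Deriv su bo (Tv v) Φ .bot) := by
  induction hΦ with
  | bot => exact ⟨by simp [mval], fun _ => .refl _⟩
  | top => exact ⟨fun _ => .refl _, by simp [mval]⟩
  | box x φ =>
    simp only [mval, decide_eq_true_eq, decide_eq_false_iff_not]
    refine ⟨?_, (deriv_Tv_box su bo v φ).2 x⟩
    rintro rfl
    exact (deriv_Tv_box su bo v φ).1
  | and _ _ ih₁ ih₂ =>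
    simp only [mval, Bool.and_eq_true, Bool.and_eq_false_iff]
    refine ⟨fun h => .lowerBound (ih₁.1 h.1) (ih₂.1 h.2), ?_⟩
    rintro (h | h)
    · exact .cut (.andE1 _ _) (ih₁.2 h)
    · exact .cut (.andE2 _ _) (ih₂.2 h)
  | or _ _ ih₁ ih₂ =>
    simp only [mval, Bool.or_eq_true, Bool.or_eq_false_iff]
    refine ⟨?_, fun h => .upperBound (ih₁.2 h.1) (ih₂.2 h.2)⟩
    rintro (h | h)
    · exact .cut (ih₁.1 h) (.orI1 _ _)
    · exact .cut (ih₂.1 h) (.orI2 _ _)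

/-- Per-model soundness and completeness of `G` relative to the
theory `T_v`, for formulas without nested modal operators. -/
theorem per_model_sound_complete [Fintype X] [DecidableEq X]
    (su : U → X → X) (bo : B → X → X → X) (v : H → X)
    (Φ Ψ : MFml X H U B) (hΦ : NoNest Φ) (hΨ : NoNest Ψ) :
    Deriv su bo (Tv v) Φ Ψ ↔ mval su bo v Φ ≤ mval su bo v Ψ := by
  rw [Bool.le_iff_imp]
  refine ⟨Deriv.sound (mval_of_mem_Tv su bo v), fun h => ?_⟩
  cases hv : mval su bo v Φ with
  | false => exact .cut ((hΦ.deriv_Tv su bo v).2 hv) (.bot _)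
  | true => exact .cut (.top _) ((hΨ.deriv_Tv su bo v).1 (h hv))
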